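/- Let $\kk$ be a field, let $R = \kk[x_1, \dots, x_n]$ be a polynomial ring, and let $S$ be a finitely generated commutative $R$-algebra (equivalently, a finitely generated $\kk$-algebra equipped with a $\kk$-algebra map $R \to S$) whose Krull dimension is at most $n$. Then the localization $\kk(x) \otimes_R S$ of $S$ at the multiplicative set of nonzero elements of $R$ is a finite-dimensional vector space over the field of rational functions $\kk(x) = \operatorname{Frac}(R)$. -/

import Mathlib

open TensorProduct

theorem gff_dim_le {R S : Type*} [CommRing R] [CommRing S] [Algebra R S]
    [Algebra.IsIntegral R S] [FaithfulSMul R S] : ringKrullDim R ≤ ringKrullDim S := by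
  refine iSup_le fun l => ?_
  obtain ⟨Q, hQ, hQ'⟩ := (inferInstance : Nonempty (Ideal.primesOver l.head.asIdeal S))
  obtain ⟨L, hL, -⟩ := Ideal.exists_ltSeries_of_hasGoingUp l Q
  rw [← hL]
  exact Order.LTSeries.length_le_krullDim L

theorem gff_alg (k : Type*) [Field k] (n : ℕ) (D : Type*) [CommRing D] [IsDomain D]
    [Algebra k D] [Algebra (MvPolynomial (Fin n) k) D] [IsScalarTower k (MvPolynomial (Fin n) k) D]
    [FaithfulSMul (MvPolynomial (Fin n) k) D] [Algebra.FiniteType k D]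
    (hdim : ringKrullDim D ≤ n) : Algebra.IsAlgebraic (MvPolynomial (Fin n) k) D := by
  have h1 := lift_trdeg_add_eq k (MvPolynomial (Fin n) k) D
  obtain ⟨s, g, hg, hfin⟩ := exists_finite_inj_algHom_of_fg k D
  have hs : Cardinal.lift (Algebra.trdeg k D) = s ∧ s ≤ n := by
    clear h1
    let := g.toRingHom.toAlgebra
    have : IsScalarTower k (MvPolynomial (Fin s) k) D :=
      IsScalarTower.of_algebraMap_eq fun x => (g.commutes x).symm
    have : FaithfulSMul (MvPolynomial (Fin s) k) D :=
      (faithfulSMul_iff_algebraMap_injective _ _).mpr hg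
    have : Module.Finite (MvPolynomial (Fin s) k) D := hfin
    have h2 := lift_trdeg_add_eq k (MvPolynomial (Fin s) k) D
    rw [trdeg_eq_zero (R := MvPolynomial (Fin s) k), MvPolynomial.trdeg_of_isDomain] at h2
    refine ⟨by simpa using h2.symm, ?_⟩
    have h3 := (gff_dim_le (R := MvPolynomial (Fin s) k) (S := D)).trans hdim
    simpa using h3
  rw [hs.1, MvPolynomial.trdeg_of_isDomain] at h1
  simp only [Cardinal.mk_fin, Cardinal.lift_natCast] at h1
  rw [← trdeg_eq_zero_iff]
  have h4 : (n : Cardinal) + Cardinal.lift (Algebra.trdeg (MvPolynomial (Fin n) k) D) ≤ 0 + n := by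
    rw [h1, zero_add]; exact_mod_cast hs.2
  have h5 := (Cardinal.add_le_add_iff_of_lt_aleph0 (Cardinal.natCast_lt_aleph0 (n := n))).mp
    ((add_comm _ _).trans_le h4)
  simpa using h5

/-- Let `R = k[x₁,…,xₙ]` and let `S` be a finitely generated
commutative `R`-algebra of Krull dimension at most `n`.  Then the localization
`k(x) ⊗_R S` of `S` at the nonzero elements of `R` is a finite-dimensional
vector space over the rational function field `k(x) = Frac(R)`. -/
theorem generic_fiber_finite (k : Type*) [Field k] (n : ℕ)
    (S : Type*) [CommRing S] [Algebra (MvPolynomial (Fin n) k) S]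
    (hfg : Algebra.FiniteType (MvPolynomial (Fin n) k) S)
    (hdim : ringKrullDim S ≤ n) :
    FiniteDimensional (FractionRing (MvPolynomial (Fin n) k))
      ((FractionRing (MvPolynomial (Fin n) k)) ⊗[MvPolynomial (Fin n) k] S) := by
  set R := MvPolynomial (Fin n) k with hR
  set K := FractionRing R with hK
  refine (Module.finite_iff_krullDimLE_zero K (K ⊗[R] S)).mpr (.mk₀ fun P hP => ?_)
  let : Algebra k S := Algebra.compHom S (algebraMap k R)
  have : IsScalarTower k R S := IsScalarTower.of_algebraMap_eq fun x => rfl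
  let f : S →ₐ[R] K ⊗[R] S := Algebra.TensorProduct.includeRight
  let Q : Ideal S := P.comap f
  have : Q.IsPrime := inferInstance
  have : Algebra.FiniteType k S := Algebra.FiniteType.trans (S := R) inferInstance hfg
  have hinj : FaithfulSMul R (S ⧸ Q) := by
    refine (faithfulSMul_iff_algebraMap_injective _ _).mpr
      ((injective_iff_map_eq_zero _).mpr fun r hr => ?_)
    by_contra h0
    have h1 : f (algebraMap R S r) ∈ P := by
      have : algebraMap R S r ∈ Q := Ideal.Quotient.eq_zero_iff_mem.mp hr
      exact this
    rw [f.commutes, IsScalarTower.algebraMap_apply R K] at h1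
    have h2 : IsUnit (algebraMap R K r) := by
      rw [isUnit_iff_ne_zero]
      exact fun h => h0 ((FaithfulSMul.algebraMap_eq_zero_iff R K).mp h)
    exact hP.ne_top (Ideal.eq_top_of_isUnit_mem _ h1 (h2.map _))
  have halg : Algebra.IsAlgebraic R (S ⧸ Q) := gff_alg k n (S ⧸ Q)
    ((ringKrullDim_le_of_surjective (Ideal.Quotient.mk Q) Ideal.Quotient.mk_surjective).trans hdim)
  let φ : (S ⧸ Q) →ₐ[R] ((K ⊗[R] S) ⧸ P) := Ideal.quotientMapₐ P f le_rfl
  have hs (s : S) : IsIntegral K (Ideal.Quotient.mk P (1 ⊗ₜ s)) := by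
    have h1 : IsAlgebraic R (φ (Ideal.Quotient.mk Q s)) := (halg.isAlgebraic _).algHom φ
    have h2 := h1.extendScalars (S := K) (FaithfulSMul.algebraMap_injective R K)
    exact h2.isIntegral
  have : Algebra.IsIntegral K ((K ⊗[R] S) ⧸ P) := by
    refine ⟨fun x => ?_⟩
    obtain ⟨x, rfl⟩ := Ideal.Quotient.mk_surjective x
    induction x using TensorProduct.induction_on with
    | zero => rw [map_zero]; exact isIntegral_zero
    | tmul a s =>
      have : a ⊗ₜ[R] s = a • (1 ⊗ₜ[R] s) := by simp [TensorProduct.smul_tmul']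
      rw [this]
      exact (hs s).smul a
    | add x y hx hy => rw [map_add]; exact hx.add hy
  exact Ideal.Quotient.maximal_of_isField P
    (isField_of_isIntegral_of_isField' (R := K) (Field.toIsField K))
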